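/- Let k ≥ 4, let G be a k-γc-critical graph with exactly k−3 cut vertices, and let D be a γc-set of G. Then G has an end block B with |(D ∩ V(B)) \ C(G)| ≥ 2. -/

import Mathlib

variable {V : Type*}

/-- `D` is a connected dominating set of `G`: every vertex is in `D` or adjacent to a
vertex of `D`, and the subgraph induced by `D` is connected. -/
def IsCDS (G : SimpleGraph V) (D : Set V) : Prop :=
  (∀ v : V, v ∈ D ∨ ∃ u ∈ D, G.Adj u v) ∧ (G.induce D).Connected

/-- The connected domination number `γc(G)`. -/
noncomputable def connDomNum (G : SimpleGraph V) : ℕ :=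
  sInf {n : ℕ | ∃ D : Set V, IsCDS G D ∧ D.ncard = n}

/-- `G + uv`: the graph `G` with the edge `uv` added. -/
def addEdge (G : SimpleGraph V) (u v : V) : SimpleGraph V :=
  G ⊔ SimpleGraph.fromEdgeSet {s(u, v)}

/-- `G` is `k`-`γc`-critical. -/
def IsCritical (G : SimpleGraph V) (k : ℕ) : Prop :=
  connDomNum G = k ∧
  ∀ u v : V, u ≠ v → ¬ G.Adj u v → connDomNum (addEdge G u v) < k

/-- `D` is a `γc`-set of `G`: a connected dominating set of minimum size. -/
def IsGammaCSet (G : SimpleGraph V) (D : Set V) : Prop :=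
  IsCDS G D ∧ D.ncard = connDomNum G

/-- `v` is a cut vertex of the connected graph `G`: `G - v` is disconnected. -/
def IsCutVertex (G : SimpleGraph V) (v : V) : Prop :=
  G.Connected ∧ ¬ (G.induce {u : V | u ≠ v}).Connected

/-- `C(G)`: the set of cut vertices of `G`. -/
def cutVertices (G : SimpleGraph V) : Set V := {v : V | IsCutVertex G v}

/-- The induced subgraph on `B` has no cut vertex of its own. -/
def NoOwnCutVertex (G : SimpleGraph V) (B : Set V) : Prop :=
  ∀ v : B, ¬ IsCutVertex (G.induce B) v

/-- `B` is (the vertex set of) a block of `G`: a maximal connected subgraph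
having no cut vertex of its own. -/
def IsBlock (G : SimpleGraph V) (B : Set V) : Prop :=
  (G.induce B).Connected ∧ NoOwnCutVertex G B ∧
  ∀ B' : Set V, B ⊆ B' → (G.induce B').Connected → NoOwnCutVertex G B' → B' = B

open Set

/-- Connectivity of an induced subgraph, expressed by closed sets of vertices. -/
theorem induce_connected_iff (G : SimpleGraph V) (S : Set V) :
    (G.induce S).Connected ↔ S.Nonempty ∧ ∀ T ⊆ S, T.Nonempty →
      (∀ a ∈ T, ∀ b ∈ S, G.Adj a b → b ∈ T) → S ⊆ T := by
  constructor
  · intro h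
    obtain ⟨s⟩ := h.nonempty
    refine ⟨⟨s, s.2⟩, fun T hTS ⟨t, ht⟩ hcl b hb => ?_⟩
    obtain ⟨p⟩ := h.preconnected ⟨t, hTS ht⟩ ⟨b, hb⟩
    have key : ∀ (u w : S), (G.induce S).Walk u w → (u : V) ∈ T → (w : V) ∈ T := by
      intro u w p
      induction p with
      | nil => exact id
      | cons hadj _ ih => exact fun hu => ih (hcl _ hu _ (Subtype.coe_prop _) hadj)
    exact key _ _ p ht
  · rintro ⟨⟨s, hs⟩, h⟩
    have : Nonempty S := ⟨⟨s, hs⟩⟩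
    refine ⟨fun u w => ?_⟩
    have := h {z | ∃ hz : z ∈ S, (G.induce S).Reachable u ⟨z, hz⟩} (fun z hz => hz.1)
      ⟨u, u.2, .refl _⟩ ?_ w.2
    · exact this.2
    · rintro a ⟨ha, hr⟩ b hb hab
      exact ⟨hb, hr.trans (SimpleGraph.Adj.reachable (by exact hab))⟩

theorem induce_singleton_connected (G : SimpleGraph V) (c : V) : (G.induce {c}).Connected :=
  (induce_connected_iff _ _).2 ⟨⟨c, rfl⟩, fun T hT ⟨t, ht⟩ _ z hz => by
    rwa [mem_singleton_iff.1 hz, ← mem_singleton_iff.1 (hT ht)]⟩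

theorem induce_induce_connected_iff (G : SimpleGraph V) (B : Set V) (S : Set B) :
    ((G.induce B).induce S).Connected ↔ (G.induce (Subtype.val '' S)).Connected := by
  refine SimpleGraph.Iso.connected_iff
    ⟨Equiv.Set.image Subtype.val S Subtype.val_injective, ?_⟩
  intro a b
  rfl

theorem connected_iff_induce_univ (G : SimpleGraph V) :
    G.Connected ↔ (G.induce univ).Connected :=
  (SimpleGraph.induceUnivIso G).connected_iff.symm

theorem SimpleGraph.Connected.eq_univ_of_closed {G : SimpleGraph V} (hG : G.Connected)
    {T : Set V} (hT : T.Nonempty) (hcl : ∀ a ∈ T, ∀ b, G.Adj a b → b ∈ T) (v : V) : v ∈ T :=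
  ((induce_connected_iff G univ).1 ((connected_iff_induce_univ G).1 hG)).2 T (subset_univ T) hT
    (fun a ha b _ => hcl a ha b) (mem_univ v)

theorem induce_connected_insert {G : SimpleGraph V} {S : Set V} {s v : V}
    (hS : (G.induce S).Connected) (hs : s ∈ S) (hsv : G.Adj s v) :
    (G.induce (insert v S)).Connected := by
  rw [induce_connected_iff] at hS ⊢
  refine ⟨⟨v, by simp⟩, fun T hT hne hcl => ?_⟩
  have h1 : s ∈ T := by
    by_cases hv : v ∈ T
    · exact hcl v hv s (by simp [hs]) hsv.symm
    · obtain ⟨t, ht⟩ := hne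
      exact hS.2 T (fun z hz => (hT hz).resolve_left (fun h => hv (h ▸ hz))) ⟨t, ht⟩
        (fun a ha b hb => hcl a ha b (by simp [hb])) hs
  have h2 := hS.2 (T ∩ S) inter_subset_right ⟨s, h1, hs⟩
    (fun a ha b hb hab => ⟨hcl a ha.1 b (by simp [hb]) hab, hb⟩)
  rintro z (rfl | hz)
  · exact hcl s h1 z (by simp) hsv
  · exact (h2 hz).1

theorem induce_connected_insert_of_dominated {G : SimpleGraph V} {S : Set V} {v : V}
    (hS : (G.induce S).Connected) (hv : v ∈ S ∨ ∃ u ∈ S, G.Adj u v) :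
    (G.induce (insert v S)).Connected := by
  rcases hv with hv | ⟨u, hu, huv⟩
  · rwa [insert_eq_of_mem hv]
  · exact induce_connected_insert hS hu huv

theorem induce_connected_union {G : SimpleGraph V} {S T : Set V} {s t : V}
    (hS : (G.induce S).Connected) (hT : (G.induce T).Connected)
    (hs : s ∈ S) (ht : t ∈ T) (hst : s = t ∨ G.Adj s t) :
    (G.induce (S ∪ T)).Connected := by
  rw [induce_connected_iff] at hS hT ⊢
  refine ⟨⟨s, by simp [hs]⟩, fun U hU ⟨u, hu⟩ hcl => ?_⟩
  have hS' : ∀ z ∈ S, z ∈ U → S ⊆ U := fun z hz hzU =>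
    (hS.2 (U ∩ S) inter_subset_right ⟨z, hzU, hz⟩
      (fun a ha b hb hab => ⟨hcl a ha.1 b (by simp [hb]) hab, hb⟩)).trans inter_subset_left
  have hT' : ∀ z ∈ T, z ∈ U → T ⊆ U := fun z hz hzU =>
    (hT.2 (U ∩ T) inter_subset_right ⟨z, hzU, hz⟩
      (fun a ha b hb hab => ⟨hcl a ha.1 b (by simp [hb]) hab, hb⟩)).trans inter_subset_left
  have h1 : s ∈ U → t ∈ U := fun h => by
    rcases hst with rfl | hst
    exacts [h, hcl s h t (by simp [ht]) hst]
  have h2 : t ∈ U → s ∈ U := fun h => by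
    rcases hst with rfl | hst
    exacts [h, hcl t h s (by simp [hs]) hst.symm]
  rcases hU hu with h | h
  · have := hS' u h hu
    exact union_subset this (hT' t ht (h1 (this hs)))
  · have := hT' u h hu
    exact union_subset (hS' s hs (h2 (this ht))) this

/-- Deleting a vertex `x` all of whose neighbours lie in the closed neighbourhood of `c`. -/
theorem induce_connected_diff_singleton {G : SimpleGraph V} {S : Set V} {x c : V}
    (hS : (G.induce S).Connected) (hc : c ∈ S) (hcx : c ≠ x)
    (h : ∀ u, G.Adj x u → u = c ∨ G.Adj u c) :
    (G.induce (S \ {x})).Connected := by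
  rw [induce_connected_iff] at hS ⊢
  refine ⟨⟨c, hc, hcx⟩, fun T hT ⟨t, ht⟩ hcl => ?_⟩
  have hcT : c ∈ T := by
    by_contra hcT
    refine hcT (hS.2 T (fun z hz => (hT hz).1) ⟨t, ht⟩ (fun a ha b hb hab => ?_) hc)
    by_cases hbx : b = x
    · subst hbx
      rcases h a hab.symm with rfl | h
      · exact absurd ha hcT
      · exact absurd (hcl a ha c ⟨hc, hcx⟩ h) hcT
    · exact hcl a ha b ⟨hb, hbx⟩ hab
  have := hS.2 (insert x T ∩ S) inter_subset_right ⟨c, by simp [hcT, hc]⟩ ?_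
  · intro z hz
    exact (this hz.1).1.resolve_left hz.2
  · rintro a ⟨ha, haS⟩ b hb hab
    refine ⟨?_, hb⟩
    by_cases hbx : b = x
    · exact Or.inl hbx
    right
    rcases ha with rfl | ha
    · rcases h b hab with rfl | h
      · exact hcT
      · exact hcl c hcT b ⟨hb, hbx⟩ h.symm
    · exact hcl a ha b ⟨hb, hbx⟩ hab

/-- Two connected sets that together dominate a connected graph become connected after adding
two suitable vertices. -/
theorem exists_connected_insert_insert {G : SimpleGraph V} (hG : G.Connected) {S T : Set V}
    (hS : (G.induce S).Connected) (hT : (G.induce T).Connected)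
    (hdom : ∀ v, v ∈ S ∪ T ∨ ∃ u ∈ S ∪ T, G.Adj u v) :
    ∃ p q, (G.induce (insert p (insert q (S ∪ T)))).Connected := by
  obtain ⟨s, hs⟩ := ((induce_connected_iff G S).1 hS).1
  by_cases hcl : ∀ a ∈ {v | v ∈ S ∨ ∃ u ∈ S, G.Adj u v}, ∀ b, G.Adj a b →
      b ∈ {v | v ∈ S ∨ ∃ u ∈ S, G.Adj u v}
  · obtain ⟨t, ht⟩ := ((induce_connected_iff G T).1 hT).1
    have := hG.eq_univ_of_closed ⟨s, Or.inl hs⟩ hcl t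
    refine ⟨t, t, ?_⟩
    have h := induce_connected_union (induce_connected_insert_of_dominated hS this) hT
      (mem_insert t S) ht (Or.inl rfl)
    convert h using 2
    all_goals simp [insert_union]
  · push Not at hcl
    obtain ⟨p, hp, q, hpq, hq⟩ := hcl
    have hq' : q ∈ T ∨ ∃ u ∈ T, G.Adj u q := by
      simp only [mem_ofPred_eq] at hq
      push Not at hq
      rcases hdom q with (h | h) | ⟨u, (h | h), h'⟩
      · exact absurd h hq.1
      · exact Or.inl h
      · exact absurd h' (hq.2 u h)
      · exact Or.inr ⟨u, h, h'⟩
    refine ⟨p, q, ?_⟩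
    have h := induce_connected_union (induce_connected_insert_of_dominated hS hp)
      (induce_connected_insert_of_dominated hT hq') (mem_insert p S) (mem_insert q T) (Or.inr hpq)
    have e : insert p S ∪ insert q T = insert p (insert q (S ∪ T)) := by
      ext; simp; tauto
    rwa [e] at h

/-- `A` is the vertex set of a component of `G - c`, and `G - c` has a further vertex. -/
structure IsBranch (G : SimpleGraph V) (A : Set V) (c : V) : Prop where
  conn : (G.induce A).Connected
  notMem : c ∉ A
  closed : ∀ a ∈ A, ∀ w, G.Adj a w → w ∈ A ∨ w = c
  exists_out : ∃ o, o ∉ A ∧ o ≠ c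

namespace IsBranch

variable {G : SimpleGraph V} {A : Set V} {c : V}

theorem nonempty (h : IsBranch G A c) : A.Nonempty := ((induce_connected_iff G A).1 h.conn).1

theorem closed_compl (h : IsBranch G A c) {a w : V} (ha : a ∉ A) (hac : a ≠ c)
    (haw : G.Adj a w) : w ∉ A :=
  fun hw => (h.closed w hw a haw.symm).elim ha hac

theorem exists_adj (h : IsBranch G A c) (hG : G.Connected) : ∃ a ∈ A, G.Adj a c := by
  by_contra! hno
  exact h.notMem (hG.eq_univ_of_closed h.nonempty (fun a ha b hab =>
    (h.closed a ha b hab).resolve_right (fun e => hno a ha (e ▸ hab))) c)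

theorem exists_adj_out (h : IsBranch G A c) (hG : G.Connected) :
    ∃ w, w ∉ A ∧ w ≠ c ∧ G.Adj w c := by
  by_contra! hno
  obtain ⟨o, hoA, hoc⟩ := h.exists_out
  obtain ⟨a, ha⟩ := h.nonempty
  refine (hG.eq_univ_of_closed (T := {z | z ∉ A ∧ z ≠ c}) ⟨o, hoA, hoc⟩ ?_ a).1 ha
  rintro z ⟨hz, hzc⟩ b hzb
  exact ⟨h.closed_compl hz hzc hzb, fun e => hno z hz hzc (e ▸ hzb)⟩

theorem isCutVertex (h : IsBranch G A c) (hG : G.Connected) : IsCutVertex G c := by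
  refine ⟨hG, fun hc => ?_⟩
  obtain ⟨o, hoA, hoc⟩ := h.exists_out
  exact hoA (((induce_connected_iff _ _).1 hc).2 A (fun a ha e => h.notMem (e ▸ ha)) h.nonempty
    (fun a ha b hb hab => (h.closed a ha b hab).resolve_right hb) hoc)

/-- A connected set meeting both `A` and its complement contains `c`. -/
theorem mem_of_connected (h : IsBranch G A c) {S : Set V} (hS : (G.induce S).Connected)
    {a b : V} (haS : a ∈ S) (ha : a ∈ A) (hbS : b ∈ S) (hb : b ∉ A) : c ∈ S := by
  by_contra hc
  refine hb (((induce_connected_iff _ _).1 hS).2 (S ∩ A) inter_subset_left ⟨a, haS, ha⟩ ?_ hbS).2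
  rintro z ⟨hzS, hz⟩ w hw hzw
  exact ⟨hw, (h.closed z hz w hzw).resolve_right (fun e => hc (e ▸ hw))⟩

theorem mem_of_isCDS (h : IsBranch G A c) {S : Set V} (hS : IsCDS G S) : c ∈ S := by
  obtain ⟨o, hoA, hoc⟩ := h.exists_out
  obtain ⟨a, ha⟩ := h.nonempty
  by_contra hc
  have h1 : ∃ z ∈ S, z ∈ A := by
    rcases hS.1 a with h1 | ⟨u, hu, hua⟩
    · exact ⟨a, h1, ha⟩
    · exact ⟨u, hu, (h.closed a ha u hua.symm).resolve_right (fun e => hc (e ▸ hu))⟩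
  have h2 : ∃ z ∈ S, z ∉ A := by
    rcases hS.1 o with h1 | ⟨u, hu, huo⟩
    · exact ⟨o, h1, hoA⟩
    · exact ⟨u, hu, h.closed_compl hoA hoc huo.symm⟩
  obtain ⟨z, hz, hzA⟩ := h1
  obtain ⟨w, hw, hwA⟩ := h2
  exact hc (h.mem_of_connected hS.2 hz hzA hw hwA)

/-- Removing from a connected set containing `c` its part in `A`. -/
theorem connected_diff (h : IsBranch G A c) {S : Set V} (hS : (G.induce S).Connected)
    (hc : c ∈ S) : (G.induce (S \ A)).Connected := by
  rw [induce_connected_iff] at hS ⊢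
  refine ⟨⟨c, hc, h.notMem⟩, fun T hT hne hcl => ?_⟩
  have hcT : c ∈ T := by
    by_contra hcT
    refine hcT (hS.2 T (fun z hz => (hT hz).1) hne (fun a ha b hb hab => ?_) hc)
    exact hcl a ha b ⟨hb, h.closed_compl (hT ha).2 (fun e => hcT (e ▸ ha)) hab⟩ hab
  intro z hz
  refine (hS.2 (T ∪ S ∩ A) (union_subset (fun z hz => (hT hz).1) inter_subset_left)
    ⟨c, Or.inl hcT⟩ ?_ hz.1).resolve_right (fun e => hz.2 e.2)
  rintro a ha b hb hab
  by_cases hbA : b ∈ A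
  · exact Or.inr ⟨hb, hbA⟩
  left
  rcases ha with ha | ha
  · exact hcl a ha b ⟨hb, hbA⟩ hab
  · rcases h.closed a ha.2 b hab with h' | rfl
    exacts [absurd h' hbA, hcT]

theorem isBlock (h : IsBranch G A c) (hG : G.Connected) (hcut : ∀ v ∈ A, ¬ IsCutVertex G v) :
    IsBlock G (insert c A) := by
  obtain ⟨a, ha, hac⟩ := h.exists_adj hG
  refine ⟨induce_connected_insert h.conn ha hac, ?_, ?_⟩
  · rintro ⟨v, hv⟩ ⟨-, hdis⟩
    rw [induce_induce_connected_iff] at hdis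
    apply hdis
    have himg : (Subtype.val '' {u : ↥(insert c A) | u ≠ ⟨v, hv⟩}) = insert c A \ {v} := by
      ext z; simp [Subtype.ext_iff, and_comm]
    rw [himg]
    rcases hv with rfl | hv
    · rw [insert_sdiff_self_of_notMem h.notMem]
      exact h.conn
    have hvc : v ≠ c := fun e => h.notMem (e ▸ hv)
    have hGv : (G.induce {u | u ≠ v}).Connected := by
      by_contra hcon
      exact hcut v hv ⟨hG, hcon⟩
    rw [induce_connected_iff] at hGv ⊢
    refine ⟨⟨c, by simp, hvc.symm⟩, fun T hT hne hcl => ?_⟩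
    have hcT : c ∈ T := by
      by_contra hcT
      refine hcT (hGv.2 T (fun z hz => (hT hz).2) hne (fun a ha b hb hab => ?_) hvc.symm)
      have haA : a ∈ A := (hT ha).1.resolve_left (fun e => hcT (e ▸ ha))
      exact hcl a ha b ⟨(h.closed a haA b hab).symm.imp id id, hb⟩ hab
    intro z hz
    refine (hGv.2 (T ∪ {u | u ∉ insert c A}) ?_ ⟨c, Or.inl hcT⟩ ?_ hz.2).resolve_right
      (fun e => e hz.1)
    · rintro u (hu | hu) rfl
      exacts [(hT hu).2 rfl, hu (Or.inr hv)]
    · rintro u hu b hb hub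
      by_cases hbB : b ∈ insert c A
      · left
        rcases hu with hu | hu
        · exact hcl u hu b ⟨hbB, hb⟩ hub
        · rcases hbB with rfl | hbA
          · exact hcT
          · exact absurd ((h.closed b hbA u hub.symm).symm.imp id id) hu
      · exact Or.inr hbB
  · intro B' hB hconn hno
    refine Subset.antisymm (fun o ho => ?_) hB
    by_contra hoB
    have hcB : c ∈ B' := hB (by simp)
    refine hno ⟨c, hcB⟩ ⟨hconn, fun hdis => ?_⟩
    rw [induce_induce_connected_iff, induce_connected_iff] at hdis
    have himg : (Subtype.val '' {u : ↥B' | u ≠ ⟨c, hcB⟩}) = B' \ {c} := by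
      ext z; simp [Subtype.ext_iff, and_comm]
    rw [himg] at hdis
    refine hoB (Or.inr (hdis.2 A ?_ h.nonempty ?_ ⟨ho, fun e => hoB (Or.inl e)⟩))
    · exact fun z hz => ⟨hB (Or.inr hz), fun e => h.notMem (e ▸ hz)⟩
    · exact fun a ha b hb hab => (h.closed a ha b hab).resolve_right hb.2

end IsBranch

/-- For a cut vertex `v` and any other vertex `c`, some component of `G - v` misses `c`. -/
theorem IsCutVertex.exists_isBranch [Finite V] {G : SimpleGraph V} {v c : V}
    (h : IsCutVertex G v) (hcv : c ≠ v) : ∃ A, IsBranch G A v ∧ c ∉ A := by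
  have hdis := h.2
  rw [induce_connected_iff] at hdis
  have hne : ∃ T : Set V, T.Nonempty ∧ v ∉ T ∧ c ∉ T ∧
      ∀ a ∈ T, ∀ b, G.Adj a b → b ∈ T ∨ b = v := by
    push Not at hdis
    obtain ⟨T, hT, hTne, hcl, hTs⟩ := hdis ⟨c, hcv⟩
    obtain ⟨o, hov, hoT⟩ := not_subset.1 hTs
    by_cases hcT : c ∈ T
    · refine ⟨{z | z ≠ v} \ T, ⟨o, hov, hoT⟩, by simp, by simp [hcT], ?_⟩
      rintro a ⟨hav, haT⟩ b hab
      by_cases hbv : b = v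
      · exact Or.inr hbv
      · exact Or.inl ⟨hbv, fun hb => haT (hcl b hb a hav hab.symm)⟩
    · refine ⟨T, hTne, fun hv => hT hv rfl, hcT, fun a ha b hab => ?_⟩
      by_cases hbv : b = v
      · exact Or.inr hbv
      · exact Or.inl (hcl a ha b hbv hab)
  obtain ⟨A, ⟨hAne, hvA, hcA, hcl⟩, hmin⟩ :=
    exists_minimal_of_wellFoundedLT _ hne
  refine ⟨A, ⟨?_, hvA, hcl, c, hcA, hcv⟩, hcA⟩
  rw [induce_connected_iff]
  refine ⟨hAne, fun T hT hTne hTcl => ?_⟩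
  refine hmin ⟨hTne, fun h => hvA (hT h), fun h => hcA (hT h), fun a ha b hab => ?_⟩ hT
  exact (hcl a (hT ha) b hab).imp (fun hb => hTcl a ha b hb hab) id

/-- Every branch contains a branch without cut vertices. -/
theorem IsBranch.exists_end [Finite V] {G : SimpleGraph V} (hG : G.Connected) {A : Set V}
    {c : V} (h : IsBranch G A c) :
    ∃ A' ⊆ A, ∃ c', IsBranch G A' c' ∧ ∀ v ∈ A', ¬ IsCutVertex G v := by
  obtain ⟨A', ⟨hA', c', hb⟩, hmin⟩ := exists_minimal_of_wellFoundedLT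
    (fun A' : Set V => A' ⊆ A ∧ ∃ c', IsBranch G A' c') ⟨A, Subset.rfl, c, h⟩
  refine ⟨A', hA', c', hb, fun v hv hcut => ?_⟩
  obtain ⟨A₂, h₂, hc'⟩ := hcut.exists_isBranch (c := c') (fun e => hb.notMem (e ▸ hv))
  have hsub : A₂ ⊆ A' := by
    intro o ho
    by_contra hoA
    have hdisj : ∀ z ∈ A₂, z ∉ A' := fun z hz hzA =>
      hc' (hb.mem_of_connected h₂.conn hz hzA ho hoA)
    refine h₂.notMem (hG.eq_univ_of_closed h₂.nonempty (fun a ha b hab => ?_) v)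
    refine (h₂.closed a ha b hab).resolve_right ?_
    rintro rfl
    exact hb.closed_compl (hdisj a ha) (fun e => hc' (e ▸ ha)) hab hv
  exact h₂.notMem (hmin ⟨hsub.trans hA', v, h₂⟩ hsub hv)

theorem addEdge_adj {G : SimpleGraph V} {u v a b : V} :
    (addEdge G u v).Adj a b ↔ G.Adj a b ∨ (a = u ∧ b = v ∨ a = v ∧ b = u) ∧ a ≠ b := by
  simp [addEdge]

theorem addEdge_comm (G : SimpleGraph V) (u v : V) : addEdge G u v = addEdge G v u := by
  rw [addEdge, addEdge, Sym2.eq_swap]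

theorem induce_connected_of_addEdge {G : SimpleGraph V} {u v : V} {S : Set V}
    (hS : ((addEdge G u v).induce S).Connected) (h : ¬ (u ∈ S ∧ v ∈ S)) :
    (G.induce S).Connected := by
  rw [induce_connected_iff] at hS ⊢
  refine ⟨hS.1, fun T hT hne hcl => hS.2 T hT hne fun a ha b hb hab => ?_⟩
  rcases addEdge_adj.1 hab with hab | ⟨⟨rfl, rfl⟩ | ⟨rfl, rfl⟩, -⟩
  · exact hcl a ha b hb hab
  · exact absurd ⟨hT ha, hb⟩ h
  · exact absurd ⟨hb, hT ha⟩ h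

theorem IsCDS.of_addEdge {G : SimpleGraph V} {D : Set V} (hD : IsCDS G D) (u v : V) :
    IsCDS (addEdge G u v) D := by
  refine ⟨fun w => (hD.1 w).imp id fun ⟨z, hz, h⟩ => ⟨z, hz, addEdge_adj.2 (Or.inl h)⟩, ?_⟩
  exact hD.2.mono fun _ _ h => addEdge_adj.2 (Or.inl h)

theorem IsCDS.connected {G : SimpleGraph V} {D : Set V} (hD : IsCDS G D) : G.Connected := by
  rw [connected_iff_induce_univ, induce_connected_iff]
  have h := (induce_connected_iff G D).1 hD.2
  obtain ⟨d, hd⟩ := h.1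
  refine ⟨⟨d, mem_univ d⟩, fun T _ ⟨t, ht⟩ hcl w _ => ?_⟩
  have hT : ∃ z ∈ D, z ∈ T := by
    rcases hD.1 t with h1 | ⟨u, hu, hut⟩
    exacts [⟨t, h1, ht⟩, ⟨u, hu, hcl t ht u (mem_univ u) hut.symm⟩]
  obtain ⟨z, hz, hzT⟩ := hT
  have hDT := h.2 (T ∩ D) inter_subset_right ⟨z, hzT, hz⟩
    (fun a ha b hb hab => ⟨hcl a ha.1 b (mem_univ b) hab, hb⟩)
  rcases hD.1 w with h1 | ⟨u, hu, huw⟩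
  exacts [(hDT h1).1, hcl u (hDT hu).1 w (mem_univ w) huw]

theorem exists_adj_of_induce_connected {G : SimpleGraph V} {S : Set V} {x c : V}
    (hS : (G.induce S).Connected) (hx : x ∈ S) (hc : c ∈ S) (hcx : c ≠ x) :
    ∃ u ∈ S, G.Adj x u := by
  by_contra! hno
  refine hcx (((induce_connected_iff G S).1 hS).2 {x} (by simpa) ⟨x, rfl⟩ ?_ hc)
  rintro a rfl b hb hab
  exact absurd hab (hno b hb)

theorem induce_connected_union_of_adj {G : SimpleGraph V} {U W : Set V} {c : V}
    (hU : (G.induce U).Connected) (hc : c ∈ U) (hW : ∀ w ∈ W, G.Adj w c) :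
    (G.induce (U ∪ W)).Connected := by
  rw [induce_connected_iff] at hU ⊢
  refine ⟨⟨c, Or.inl hc⟩, fun T hT ⟨t, ht⟩ hcl => ?_⟩
  have hcT : c ∈ T := by
    rcases hT ht with h | h
    · exact (hU.2 (T ∩ U) inter_subset_right ⟨t, ht, h⟩
        (fun a ha b hb hab => ⟨hcl a ha.1 b (Or.inl hb) hab, hb⟩) hc).1
    · exact hcl t ht c (Or.inl hc) (hW t h)
  rintro z (hz | hz)
  · exact (hU.2 (T ∩ U) inter_subset_right ⟨c, hcT, hc⟩
      (fun a ha b hb hab => ⟨hcl a ha.1 b (Or.inl hb) hab, hb⟩) hz).1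
  · exact hcl c hcT z (Or.inr hz) (hW z hz).symm

theorem IsBranch.isBranch_addEdge {G : SimpleGraph V} {A : Set V} {c u v : V} (h : IsBranch G A c)
    (hu : u ∈ insert c A) (hv : v ∈ insert c A) : IsBranch (addEdge G u v) A c := by
  refine ⟨h.conn.mono fun _ _ h => addEdge_adj.2 (Or.inl h), h.notMem, fun a ha w haw => ?_,
    h.exists_out⟩
  rcases addEdge_adj.1 haw with haw | ⟨⟨-, rfl⟩ | ⟨-, rfl⟩, -⟩
  exacts [h.closed a ha w haw, hv.symm.imp id id, hu.symm.imp id id]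

/-- A branch `A` at `c` together with `x ∈ A` such that `c` dominates `A`, except possibly for
the vertex `x`, which is then adjacent to all other vertices of `A`. -/
structure IsSmallEnd (G : SimpleGraph V) (A : Set V) (c x : V) : Prop
    extends IsBranch G A c where
  mem : x ∈ A
  adj_of_ne : ∀ a ∈ A, a ≠ x → G.Adj a c
  adj_or : G.Adj x c ∨ ∀ a ∈ A, a ≠ x → G.Adj a x

/-- If adding any edge lowers the connected domination number, a branch containing at most one
vertex of a minimum connected dominating set is a small end. -/
theorem IsBranch.exists_isSmallEnd [Finite V] {G : SimpleGraph V} {A D : Set V} {c : V}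
    (h : IsBranch G A c) (hD : IsCDS G D) (hmin : ∀ D', IsCDS G D' → D.ncard ≤ D'.ncard)
    (hcrit : ∀ u v, u ≠ v → ¬ G.Adj u v → ∃ D', IsCDS (addEdge G u v) D' ∧
      D'.ncard < D.ncard)
    (hcard : (D ∩ A).ncard ≤ 1) : ∃ x, IsSmallEnd G A c x := by
  have hcD := h.mem_of_isCDS hD
  by_cases hall : ∀ a ∈ A, G.Adj a c
  · obtain ⟨x, hx⟩ := h.nonempty
    exact ⟨x, h, hx, fun a ha _ => hall a ha, Or.inl (hall x hx)⟩
  push Not at hall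
  obtain ⟨x, hx, hxc⟩ := hall
  have hxne : x ≠ c := fun e => h.notMem (e ▸ hx)
  obtain ⟨a, haD, haA⟩ : (D ∩ A).Nonempty := by
    rcases hD.1 x with hxD | ⟨u, hu, hux⟩
    · exact ⟨x, hxD, hx⟩
    · refine ⟨u, hu, (h.closed x hx u hux.symm).resolve_right ?_⟩
      rintro rfl
      exact hxc hux.symm
  have huniq : ∀ z ∈ D, z ∈ A → z = a := fun z hz hzA =>
    (ncard_le_one (toFinite _)).1 hcard z ⟨hz, hzA⟩ a ⟨haD, haA⟩
  have hac : G.Adj a c := by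
    obtain ⟨u, hu, hau⟩ := exists_adj_of_induce_connected hD.2 haD hcD
      (fun e => h.notMem (e ▸ haA))
    rcases h.closed a haA u hau with huA | rfl
    · exact absurd (huniq u hu huA) hau.ne'
    · exact hau
  have key : ∀ u ∈ insert c A, ∀ v ∈ insert c A, u ≠ v → ¬ G.Adj u v →
      ∀ y ∈ A, (addEdge G u v).Adj c y := by
    intro u hu v hv huv hnadj y hy
    obtain ⟨D', hD', hlt⟩ := hcrit u v huv hnadj
    have hb := h.isBranch_addEdge hu hv
    have hcD' := hb.mem_of_isCDS hD'
    by_cases hne : ∃ z ∈ D', z ∈ A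
    · exfalso
      obtain ⟨z, hz, hzA⟩ := hne
      have hconn : (G.induce (D' \ A)).Connected := by
        refine induce_connected_of_addEdge (hb.connected_diff hD'.2 hcD') ?_
        rintro ⟨hu', hv'⟩
        exact huv ((hu.resolve_right hu'.2).trans (hv.resolve_right hv'.2).symm)
      have hN : IsCDS G (insert a (D' \ A)) := by
        refine ⟨fun w => ?_, induce_connected_insert hconn ⟨hcD', h.notMem⟩ hac.symm⟩
        by_cases hwA : w ∈ A
        · rcases hD.1 w with hw | ⟨s, hs, hsw⟩
          · exact Or.inl (Or.inl (huniq w hw hwA))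
          · refine Or.inr ⟨s, ?_, hsw⟩
            rcases h.closed w hwA s hsw.symm with hsA | rfl
            · exact Or.inl (huniq s hs hsA)
            · exact Or.inr ⟨hcD', h.notMem⟩
        by_cases hwc : w = c
        · exact Or.inl (Or.inr ⟨hwc ▸ hcD', hwA⟩)
        rcases hD'.1 w with hw | ⟨s, hs, hsw⟩
        · exact Or.inl (Or.inr ⟨hw, hwA⟩)
        · refine Or.inr ⟨s, Or.inr ⟨hs, hb.closed_compl hwA hwc hsw.symm⟩, ?_⟩
          rcases addEdge_adj.1 hsw with hsw | ⟨⟨-, rfl⟩ | ⟨-, rfl⟩, -⟩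
          · exact hsw
          · exact absurd hv (by simp [hwA, hwc])
          · exact absurd hu (by simp [hwA, hwc])
      have h1 := hmin _ hN
      have h2 := ncard_insert_le a (D' \ A)
      have h3 : (D' \ A).ncard < D'.ncard :=
        ncard_lt_ncard ⟨sdiff_subset, fun hs => (hs hz).2 hzA⟩ (toFinite _)
      omega
    · push Not at hne
      rcases hD'.1 y with hyD | ⟨s, hs, hsy⟩
      · exact absurd hy (hne y hyD)
      · rcases hb.closed y hy s hsy.symm with hsA | rfl
        · exact absurd hsA (hne s hs)
        · exact hsy
  have hxB : x ∈ insert c A := Or.inr hx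
  have hcB : c ∈ insert c A := Or.inl rfl
  refine ⟨x, h, hx, fun y hy hyx => ?_, Or.inr fun y hy hyx => ?_⟩
  · rcases addEdge_adj.1 (key x hxB c hcB hxne hxc y hy) with h1 | ⟨⟨h1, -⟩ | ⟨-, h1⟩, -⟩
    · exact h1.symm
    · exact absurd h1.symm hxne
    · exact absurd h1 hyx
  · by_contra hyx'
    rcases addEdge_adj.1 (key y (Or.inr hy) x hxB hyx hyx' x hx) with h1 | ⟨⟨h1, -⟩ | ⟨h1, -⟩, -⟩
    · exact hxc h1.symm
    · exact h.notMem (h1 ▸ hy)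
    · exact hxne h1.symm

namespace IsSmallEnd

variable {G : SimpleGraph V} {A A' : Set V} {c c' x x' : V}

theorem ne (h : IsSmallEnd G A c x) : c ≠ x := fun e => h.notMem (e ▸ h.mem)

theorem eq_or_adj (h : IsSmallEnd G A c x) (u : V) (hu : G.Adj x u) : u = c ∨ G.Adj u c := by
  rcases h.closed x h.mem u hu with hA | rfl
  · exact Or.inr (h.adj_of_ne u hA hu.ne')
  · exact Or.inl rfl

theorem connected_diff_singleton (h : IsSmallEnd G A c x) {S : Set V}
    (hS : (G.induce S).Connected) (hc : c ∈ S) : (G.induce (S \ {x})).Connected :=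
  induce_connected_diff_singleton hS hc h.ne h.eq_or_adj

theorem dominated_diff (h : IsSmallEnd G A c x) {S : Set V} (hc : c ∈ S) {v : V} (hvx : v ≠ x)
    (hv : v ∈ S ∨ ∃ u ∈ S, G.Adj u v) : v ∈ S \ {x} ∨ ∃ u ∈ S \ {x}, G.Adj u v := by
  rcases hv with hv | ⟨u, hu, huv⟩
  · exact Or.inl ⟨hv, hvx⟩
  by_cases hux : u = x
  · subst hux
    rcases h.eq_or_adj v huv with rfl | hvc
    · exact Or.inl ⟨hc, hvx⟩
    · exact Or.inr ⟨c, ⟨hc, h.ne⟩, hvc.symm⟩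
  · exact Or.inr ⟨u, ⟨hu, hux⟩, huv⟩

theorem exists_adj_self (h : IsSmallEnd G A c x) {S : Set V} (hS : (G.induce S).Connected)
    (hc : c ∈ S) (hx : x ∈ S) : ∃ u ∈ S \ {x}, G.Adj u x := by
  obtain ⟨u, hu, hxu⟩ := exists_adj_of_induce_connected hS hx hc h.ne
  exact ⟨u, ⟨hu, hxu.ne'⟩, hxu.symm⟩

theorem adj_or_exists_adj (h : IsSmallEnd G A c x) {S : Set V} (hS : S ⊆ A)
    (hc : ∃ u ∈ S, G.Adj u c) : G.Adj x c ∨ ∃ u ∈ S \ {x}, G.Adj u x := by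
  obtain ⟨u, hu, huc⟩ := hc
  by_cases hux : u = x
  · exact Or.inl (hux ▸ huc)
  · exact h.adj_or.imp id fun h' => ⟨u, ⟨hu, hux⟩, h' u (hS hu) hux⟩

theorem adj_of_mem_diff (h : IsSmallEnd G A c x) {S : Set V} (hS : S ⊆ A) (w : V)
    (hw : w ∈ S \ {x}) : G.Adj w c := h.adj_of_ne w (hS hw.1) hw.2

/-- For every `a ∈ A`, the set `{a, c}` dominates `A`. -/
theorem dominated_pair (h : IsSmallEnd G A c x) {a v : V} (ha : a ∈ A) (hv : v ∈ A) :
    G.Adj c v ∨ v = a ∨ G.Adj a v := by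
  by_cases hvx : v = x
  · subst hvx
    by_cases hva : v = a
    · exact Or.inr (Or.inl hva)
    · rcases h.adj_or with h' | h'
      exacts [Or.inl h'.symm, Or.inr (Or.inr (h' a ha (Ne.symm hva)))]
  · exact Or.inl (h.adj_of_ne v hv hvx).symm

end IsSmallEnd

section TwoEnds

variable {G : SimpleGraph V} {A A' S S' : Set V} {c c' x x' : V}

theorem exists_isCDS_of_mem_of_mem (hG : G.Connected) (h : IsSmallEnd G A c x)
    (h' : IsSmallEnd G A' c' x') (hS : (G.induce S).Connected) (hS' : (G.induce S').Connected)
    (hx : x ∈ S) (hx' : x' ∈ S') (hdom : ∀ v, v ∈ S ∪ S' ∨ ∃ u ∈ S ∪ S', G.Adj u v)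
    (hc : c ∈ S) (hc' : c' ∈ S') :
    ∃ p q, IsCDS G (insert p (insert q (S \ {x} ∪ S' \ {x'}))) := by
  have hdom' : ∀ v, v ∈ S \ {x} ∪ S' \ {x'} ∨ ∃ u ∈ S \ {x} ∪ S' \ {x'}, G.Adj u v := by
    have left : ∀ v, (v ∈ S ∨ ∃ u ∈ S, G.Adj u v) →
        v ∈ S \ {x} ∪ S' \ {x'} ∨ ∃ u ∈ S \ {x} ∪ S' \ {x'}, G.Adj u v := by
      intro v hv
      by_cases hvx : v = x
      · obtain ⟨u, hu, hux⟩ := h.exists_adj_self hS hc hx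
        exact Or.inr ⟨u, Or.inl hu, hvx ▸ hux⟩
      · exact (h.dominated_diff hc hvx hv).imp Or.inl fun ⟨u, hu, huv⟩ => ⟨u, Or.inl hu, huv⟩
    have right : ∀ v, (v ∈ S' ∨ ∃ u ∈ S', G.Adj u v) →
        v ∈ S \ {x} ∪ S' \ {x'} ∨ ∃ u ∈ S \ {x} ∪ S' \ {x'}, G.Adj u v := by
      intro v hv
      by_cases hvx : v = x'
      · obtain ⟨u, hu, hux⟩ := h'.exists_adj_self hS' hc' hx'
        exact Or.inr ⟨u, Or.inr hu, hvx ▸ hux⟩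
      · exact (h'.dominated_diff hc' hvx hv).imp Or.inr fun ⟨u, hu, huv⟩ => ⟨u, Or.inr hu, huv⟩
    intro v
    rcases hdom v with (hv | hv) | ⟨u, hu | hu, huv⟩
    exacts [left v (Or.inl hv), right v (Or.inl hv), left v (Or.inr ⟨u, hu, huv⟩),
      right v (Or.inr ⟨u, hu, huv⟩)]
  obtain ⟨p, q, hpq⟩ := exists_connected_insert_insert hG (h.connected_diff_singleton hS hc)
    (h'.connected_diff_singleton hS' hc') hdom'
  exact ⟨p, q, fun v => (hdom' v).imp (fun hv => Or.inr (Or.inr hv))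
    fun ⟨u, hu, huv⟩ => ⟨u, Or.inr (Or.inr hu), huv⟩, hpq⟩

theorem exists_isCDS_of_notMem_of_mem (hG : G.Connected) (h : IsSmallEnd G A c x)
    (h' : IsSmallEnd G A' c' x') (hAA : Disjoint A A') (hcA' : c ∉ A')
    (hS : (G.induce S).Connected) (hS' : (G.induce S').Connected)
    (hx : x ∈ S) (hx' : x' ∈ S') (hdom : ∀ v, v ∈ S ∪ S' ∨ ∃ u ∈ S ∪ S', G.Adj u v)
    (hc : c ∉ S) (hc' : c' ∈ S') :
    ∃ p q, IsCDS G (insert p (insert q (S \ {x} ∪ S' \ {x'}))) := by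
  have hSA : S ⊆ A := fun z hz => by
    by_contra hzA
    exact hc (h.mem_of_connected hS hx h.mem hz hzA)
  have hT := h'.connected_diff_singleton hS' hc'
  have hTx : x' ∉ A := fun hA => disjoint_left.1 hAA hA h'.mem
  have hx'dom := h'.exists_adj_self hS' hc' hx'
  have hout : ∀ v, v ∉ A → v ≠ c → v ∈ S' \ {x'} ∨ ∃ u ∈ S' \ {x'}, G.Adj u v := by
    intro v hvA hvc
    by_cases hvx : v = x'
    · exact Or.inr (hvx ▸ hx'dom)
    refine h'.dominated_diff hc' hvx ?_
    rcases hdom v with (hv | hv) | ⟨u, hu | hu, huv⟩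
    · exact absurd (hSA hv) hvA
    · exact Or.inl hv
    · exact absurd (hSA hu) (h.closed_compl hvA hvc huv.symm)
    · exact Or.inr ⟨u, hu, huv⟩
  by_cases hcT : c ∈ S' \ {x'} ∨ ∃ u ∈ S' \ {x'}, G.Adj u c
  · obtain ⟨a, haA, hac⟩ := h.exists_adj hG
    refine ⟨c, a, fun v => ?_, ?_⟩
    · by_cases hvA : v ∈ A
      · rcases h.dominated_pair haA hvA with h1 | rfl | h1
        · exact Or.inr ⟨c, by simp, h1⟩
        · exact Or.inl (by simp)
        · exact Or.inr ⟨a, by simp, h1⟩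
      by_cases hvc : v = c
      · exact Or.inl (Or.inl hvc)
      · exact (hout v hvA hvc).imp (fun hv => Or.inr (Or.inr (Or.inr hv)))
          fun ⟨u, hu, huv⟩ => ⟨u, Or.inr (Or.inr (Or.inr hu)), huv⟩
    · have := induce_connected_union_of_adj (W := insert a (S \ {x}))
        (induce_connected_insert_of_dominated hT hcT) (mem_insert c _) (by
          rintro w (rfl | hw)
          exacts [hac, h.adj_of_mem_diff hSA w hw])
      have e : insert c (insert a (S \ {x} ∪ S' \ {x'})) =
          insert c (S' \ {x'}) ∪ insert a (S \ {x}) := by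
        ext; simp only [mem_union, mem_insert_iff]; tauto
      rwa [e]
  · obtain ⟨w, hwA, hwc, hwadj⟩ := h.exists_adj_out hG
    have hcx' : c ≠ x' := fun e => hcA' (e ▸ h'.mem)
    have hScdom : ∃ u ∈ S, G.Adj u c := by
      rcases hdom c with (hv | hv) | ⟨u, hu | hu, huv⟩
      · exact absurd hv hc
      · exact absurd (Or.inl ⟨hv, hcx'⟩) hcT
      · exact ⟨u, hu, huv⟩
      · exact absurd (h'.dominated_diff hc' hcx' (Or.inr ⟨u, hu, huv⟩)) hcT
    refine ⟨c, w, fun v => ?_, ?_⟩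
    · by_cases hvA : v ∈ A
      · right
        by_cases hvx : v = x
        · subst hvx
          rcases h.adj_or_exists_adj hSA hScdom with h1 | ⟨u, hu, h1⟩
          · exact ⟨c, by simp, h1.symm⟩
          · exact ⟨u, Or.inr (Or.inr (Or.inl hu)), h1⟩
        · exact ⟨c, by simp, (h.adj_of_ne v hvA hvx).symm⟩
      by_cases hvc : v = c
      · exact Or.inl (Or.inl hvc)
      · exact (hout v hvA hvc).imp (fun hv => Or.inr (Or.inr (Or.inr hv)))
          fun ⟨u, hu, huv⟩ => ⟨u, Or.inr (Or.inr (Or.inr hu)), huv⟩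
    · have := induce_connected_union_of_adj (W := S \ {x})
        (induce_connected_insert (induce_connected_insert_of_dominated hT (hout w hwA hwc))
          (mem_insert w _) hwadj)
        (mem_insert c _) (h.adj_of_mem_diff hSA)
      have e : insert c (insert w (S \ {x} ∪ S' \ {x'})) =
          insert c (insert w (S' \ {x'})) ∪ S \ {x} := by
        ext; simp only [mem_union, mem_insert_iff]; tauto
      rwa [e]

theorem exists_isCDS_of_notMem_of_notMem (hG : G.Connected) (h : IsSmallEnd G A c x)
    (h' : IsSmallEnd G A' c' x') (hcA' : c ∉ A') (hc'A : c' ∉ A)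
    (hS : (G.induce S).Connected) (hS' : (G.induce S').Connected)
    (hx : x ∈ S) (hx' : x' ∈ S') (hdom : ∀ v, v ∈ S ∪ S' ∨ ∃ u ∈ S ∪ S', G.Adj u v)
    (hc : c ∉ S) (hc' : c' ∉ S') :
    (∃ p q, IsCDS G (insert p (insert q (S \ {x} ∪ S' \ {x'})))) ∨
      ∃ p q r, IsCDS G {p, q, r} := by
  have hSA : S ⊆ A := fun z hz => by
    by_contra hzA
    exact hc (h.mem_of_connected hS hx h.mem hz hzA)
  have hSA' : S' ⊆ A' := fun z hz => by
    by_contra hzA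
    exact hc' (h'.mem_of_connected hS' hx' h'.mem hz hzA)
  have hV : ∀ v, v ∈ A ∨ v ∈ A' ∨ v = c ∨ v = c' := by
    intro v
    rcases hdom v with (hv | hv) | ⟨u, hu | hu, huv⟩
    · exact Or.inl (hSA hv)
    · exact Or.inr (Or.inl (hSA' hv))
    · have := h.closed u (hSA hu) v huv
      tauto
    · have := h'.closed u (hSA' hu) v huv
      tauto
  by_cases hcc : c = c'
  · subst hcc
    right
    obtain ⟨a, haA, hac⟩ := h.exists_adj hG
    obtain ⟨b, hbA, hbc⟩ := h'.exists_adj hG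
    refine ⟨a, b, c, fun v => ?_, ?_⟩
    · rcases hV v with hv | hv | rfl | rfl
      · rcases h.dominated_pair haA hv with h1 | rfl | h1
        exacts [Or.inr ⟨c, by simp, h1⟩, Or.inl (by simp), Or.inr ⟨a, by simp, h1⟩]
      · rcases h'.dominated_pair hbA hv with h1 | rfl | h1
        exacts [Or.inr ⟨c, by simp, h1⟩, Or.inl (by simp), Or.inr ⟨b, by simp, h1⟩]
      all_goals exact Or.inl (by simp)
    · refine induce_connected_insert (s := c) (induce_connected_insert (s := c) ?_ rfl hbc.symm)
        (by simp) hac.symm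
      exact induce_singleton_connected G c
  left
  have hadj : G.Adj c' c := by
    obtain ⟨w, hwA, hwc, hw⟩ := h.exists_adj_out hG
    rcases hV w with hv | hv | rfl | rfl
    · exact absurd hv hwA
    · exact ((h'.closed w hv c hw).elim hcA' hcc).elim
    · exact absurd rfl hwc
    · exact hw
  have hd : ∃ u ∈ S, G.Adj u c := by
    rcases hdom c with (hv | hv) | ⟨u, hu | hu, huv⟩
    · exact absurd hv hc
    · exact absurd (hSA' hv) hcA'
    · exact ⟨u, hu, huv⟩
    · exact ((h'.closed u (hSA' hu) c huv).elim hcA' hcc).elim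
  have hd' : ∃ u ∈ S', G.Adj u c' := by
    rcases hdom c' with (hv | hv) | ⟨u, hu | hu, huv⟩
    · exact absurd (hSA hv) hc'A
    · exact absurd hv hc'
    · exact ((h.closed u (hSA hu) c' huv).elim hc'A (Ne.symm hcc)).elim
    · exact ⟨u, hu, huv⟩
  refine ⟨c, c', fun v => ?_, ?_⟩
  · rcases hV v with hv | hv | rfl | rfl
    · right
      by_cases hvx : v = x
      · subst hvx
        rcases h.adj_or_exists_adj hSA hd with h1 | ⟨u, hu, h1⟩
        · exact ⟨c, by simp, h1.symm⟩
        · exact ⟨u, Or.inr (Or.inr (Or.inl hu)), h1⟩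
      · exact ⟨c, by simp, (h.adj_of_ne v hv hvx).symm⟩
    · right
      by_cases hvx : v = x'
      · subst hvx
        rcases h'.adj_or_exists_adj hSA' hd' with h1 | ⟨u, hu, h1⟩
        · exact ⟨c', by simp, h1.symm⟩
        · exact ⟨u, Or.inr (Or.inr (Or.inr hu)), h1⟩
      · exact ⟨c', by simp, (h'.adj_of_ne v hv hvx).symm⟩
    all_goals exact Or.inl (by simp)
  · have h0 : (G.induce {c, c'}).Connected := by
      refine induce_connected_insert (s := c') ?_ rfl hadj
      exact induce_singleton_connected G c'
    have h1 := induce_connected_union_of_adj h0 (c := c) (by simp) (h.adj_of_mem_diff hSA)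
    have h2 := induce_connected_union_of_adj h1 (c := c') (by simp) (h'.adj_of_mem_diff hSA')
    rwa [union_assoc, insert_union, singleton_union] at h2

/-- The case in which the new edge joins two connected sets. -/
theorem exists_isCDS_of_disjoint_union [Finite V] (hG : G.Connected) (h : IsSmallEnd G A c x)
    (h' : IsSmallEnd G A' c' x') (hAA : Disjoint A A') (hcA' : c ∉ A') (hc'A : c' ∉ A)
    (hS : (G.induce S).Connected) (hS' : (G.induce S').Connected) (hSS : Disjoint S S')
    (hx : x ∈ S) (hx' : x' ∈ S') (hdom : ∀ v, v ∈ S ∪ S' ∨ ∃ u ∈ S ∪ S', G.Adj u v) :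
    ∃ N, IsCDS G N ∧ (N.ncard ≤ (S ∪ S').ncard ∨ N.ncard ≤ 3) := by
  have hcard : ∀ p q, (insert p (insert q (S \ {x} ∪ S' \ {x'}))).ncard ≤ (S ∪ S').ncard := by
    intro p q
    have h1 := ncard_insert_le p (insert q (S \ {x} ∪ S' \ {x'}))
    have h2 := ncard_insert_le q (S \ {x} ∪ S' \ {x'})
    have h3 := ncard_union_le (S \ {x}) (S' \ {x'})
    have h4 := ncard_sdiff_singleton_add_one hx (toFinite S)
    have h5 := ncard_sdiff_singleton_add_one hx' (toFinite S')
    have h6 := ncard_union_eq hSS (toFinite S) (toFinite S')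
    omega
  by_cases hc : c ∈ S <;> by_cases hc' : c' ∈ S'
  · obtain ⟨p, q, hN⟩ := exists_isCDS_of_mem_of_mem hG h h' hS hS' hx hx' hdom hc hc'
    exact ⟨_, hN, Or.inl (hcard p q)⟩
  · obtain ⟨p, q, hN⟩ := exists_isCDS_of_notMem_of_mem hG h' h hAA.symm hc'A hS' hS hx' hx
      (by simpa only [union_comm] using hdom) hc' hc
    rw [union_comm] at hN
    exact ⟨_, hN, Or.inl (hcard p q)⟩
  · obtain ⟨p, q, hN⟩ := exists_isCDS_of_notMem_of_mem hG h h' hAA hcA' hS hS' hx hx' hdom hc hc'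
    exact ⟨_, hN, Or.inl (hcard p q)⟩
  · rcases exists_isCDS_of_notMem_of_notMem hG h h' hcA' hc'A hS hS' hx hx' hdom hc hc' with
      ⟨p, q, hN⟩ | ⟨p, q, r, hN⟩
    · exact ⟨_, hN, Or.inl (hcard p q)⟩
    · refine ⟨_, hN, Or.inr ?_⟩
      have h1 := ncard_insert_le p {q, r}
      have h2 := ncard_insert_le q {r}
      have h3 := ncard_singleton r
      omega

theorem induce_connected_of_closed_addEdge {D : Set V}
    (hD : ((addEdge G x x').induce D).Connected) (hSD : S ⊆ D) (hx : x ∈ S) (hx' : x' ∉ S)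
    (hcl : ∀ a ∈ S, ∀ b ∈ D, G.Adj a b → b ∈ S) : (G.induce S).Connected := by
  rw [induce_connected_iff] at hD ⊢
  have key : ∀ T ⊆ S, T.Nonempty → x ∉ T → ¬ ∀ a ∈ T, ∀ b ∈ S, G.Adj a b → b ∈ T := by
    intro T hT hne hxT hTcl
    refine hxT (hD.2 T (hT.trans hSD) hne (fun a ha b hb hab => ?_) (hSD hx))
    rcases addEdge_adj.1 hab with hab | ⟨⟨rfl, -⟩ | ⟨rfl, -⟩, -⟩
    · exact hTcl a ha b (hcl a (hT ha) b hb hab) hab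
    · exact absurd ha hxT
    · exact absurd (hT ha) hx'
  refine ⟨⟨x, hx⟩, fun T hT hne hTcl => ?_⟩
  have hxT : x ∈ T := by
    by_contra hxT
    exact key T hT hne hxT hTcl
  by_contra hST
  obtain ⟨o, hoS, hoT⟩ := not_subset.1 hST
  refine key (S \ T) sdiff_subset ⟨o, hoS, hoT⟩ (fun h => h.2 hxT) ?_
  exact fun a ha b hb hab => ⟨hb, fun hbT => ha.2 (hTcl b hbT a ha.1 hab.symm)⟩

/-- If `D` becomes connected by adding an edge, that edge joins two connected pieces. -/
theorem exists_disjoint_union_of_addEdge {D : Set V}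
    (hD : ((addEdge G x x').induce D).Connected) (hG : ¬ (G.induce D).Connected) :
    ∃ S S', S ∪ S' = D ∧ Disjoint S S' ∧ x ∈ S ∧ x' ∈ S' ∧
      (G.induce S).Connected ∧ (G.induce S').Connected := by
  have hxD : x ∈ D ∧ x' ∈ D := by
    by_contra hcon
    exact hG (induce_connected_of_addEdge hD hcon)
  have split : ∃ S ⊆ D, x ∈ S ∧ x' ∉ S ∧ ∀ a ∈ S, ∀ b ∈ D, G.Adj a b → b ∈ S := by
    rw [induce_connected_iff] at hG hD
    push Not at hG
    obtain ⟨T, hT, hne, hcl, hDT⟩ := hG hD.1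
    have hcl' : ∀ a ∈ D \ T, ∀ b ∈ D, G.Adj a b → b ∈ D \ T :=
      fun a ha b hb hab => ⟨hb, fun hbT => ha.2 (hcl b hbT a ha.1 hab.symm)⟩
    have hcross : ¬ (x ∈ T ↔ x' ∈ T) := by
      intro hiff
      refine hDT (hD.2 T hT hne fun a ha b hb hab => ?_)
      rcases addEdge_adj.1 hab with hab | ⟨⟨rfl, rfl⟩ | ⟨rfl, rfl⟩, -⟩
      exacts [hcl a ha b hb hab, hiff.1 ha, hiff.2 ha]
    by_cases hx : x ∈ T
    · exact ⟨T, hT, hx, by tauto, hcl⟩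
    · exact ⟨D \ T, sdiff_subset, ⟨hxD.1, hx⟩, fun h => h.2 (by tauto), hcl'⟩
  obtain ⟨S, hSD, hx, hx', hcl⟩ := split
  refine ⟨S, D \ S, union_sdiff_cancel hSD, disjoint_sdiff_right, hx, ⟨hxD.2, hx'⟩,
    induce_connected_of_closed_addEdge hD hSD hx hx' hcl, ?_⟩
  rw [addEdge_comm] at hD
  exact induce_connected_of_closed_addEdge hD sdiff_subset ⟨hxD.2, hx'⟩ (fun h => h.2 hx)
    fun a ha b hb hab => ⟨hb, fun hbS => ha.2 (hcl b hbS a ha.1 hab.symm)⟩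

/-- The case in which exactly one end of the new edge is used. -/
theorem exists_isCDS_of_mem_of_notMem [Finite V] {D : Set V} (hG : G.Connected)
    (h : IsSmallEnd G A c x) (h' : IsSmallEnd G A' c' x') (hAA : Disjoint A A')
    (hcA' : c ∉ A') (hc'A : c' ∉ A) (hD : IsCDS (addEdge G x x') D) (hx : x ∈ D)
    (hx' : x' ∉ D) : ∃ N, IsCDS G N ∧ (N.ncard ≤ D.ncard ∨ N.ncard ≤ 3) := by
  have hconn : (G.induce D).Connected := induce_connected_of_addEdge hD.2 fun e => hx' e.2
  have hdom : ∀ v, v ≠ x' → v ∈ D ∨ ∃ u ∈ D, G.Adj u v := by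
    intro v hv
    rcases hD.1 v with hvD | ⟨u, hu, huv⟩
    · exact Or.inl hvD
    rcases addEdge_adj.1 huv with huv | ⟨⟨-, rfl⟩ | ⟨rfl, -⟩, -⟩
    exacts [Or.inr ⟨u, hu, huv⟩, absurd rfl hv, absurd hu hx']
  have hxA' : x ∉ A' := disjoint_left.1 hAA h.mem
  have hx'A : x' ∉ A := disjoint_right.1 hAA h'.mem
  have hcx' : c ≠ x' := fun e => hcA' (e ▸ h'.mem)
  have hc'x : c' ≠ x := fun e => hc'A (e ▸ h.mem)
  have hcardN : ∀ a, (insert a (D \ {x})).ncard ≤ D.ncard := by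
    intro a
    have h1 := ncard_insert_le a (D \ {x})
    have h2 := ncard_sdiff_singleton_add_one hx (toFinite D)
    omega
  by_cases hn : ∃ u ∈ D, G.Adj u x'
  · refine ⟨D, ⟨fun v => ?_, hconn⟩, Or.inl le_rfl⟩
    by_cases hv : v = x'
    · exact Or.inr (hv ▸ hn)
    · exact hdom v hv
  have hdom' : c ∈ D → ∀ v, v ≠ x' → v ∈ D \ {x} ∨ ∃ u ∈ D \ {x}, G.Adj u v := by
    intro hc v hv
    by_cases hvx : v = x
    · exact Or.inr (hvx ▸ h.exists_adj_self hconn hc hx)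
    · exact h.dominated_diff hc hvx (hdom v hv)
  by_cases hc' : c' ∈ D
  · have hc : c ∈ D := h.mem_of_connected hconn hx h.mem hc' hc'A
    obtain ⟨a, haA, hac⟩ := h'.exists_adj hG
    have hax' : a = x' ∨ G.Adj a x' := by
      by_cases hax : a = x'
      · exact Or.inl hax
      rcases h'.adj_or with h1 | h1
      exacts [absurd ⟨c', hc', h1.symm⟩ hn, Or.inr (h1 a haA hax)]
    refine ⟨insert a (D \ {x}), ⟨fun v => ?_, ?_⟩, Or.inl (hcardN a)⟩
    · by_cases hv : v = x'
      · subst hv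
        rcases hax' with rfl | hax'
        exacts [Or.inl (mem_insert _ _), Or.inr ⟨a, mem_insert _ _, hax'⟩]
      · exact (hdom' hc v hv).imp Or.inr fun ⟨u, hu, huv⟩ => ⟨u, Or.inr hu, huv⟩
    · exact induce_connected_insert (h.connected_diff_singleton hconn hc) ⟨hc', hc'x⟩ hac.symm
  have hDA' : ∀ z ∈ D, z ∉ A' := fun z hz hzA =>
    hc' (h'.mem_of_connected hconn hz hzA hx hxA')
  have hA' : ∀ z ∈ A', z = x' := by
    intro z hz
    by_contra hzx
    rcases hdom z hzx with hzD | ⟨u, hu, huz⟩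
    · exact hDA' z hzD hz
    · rcases h'.closed z hz u huz.symm with huA | rfl
      exacts [hDA' u hu huA, hc' hu]
  have hx'c' : G.Adj c' x' := by
    obtain ⟨a, haA, hac⟩ := h'.exists_adj hG
    exact hA' a haA ▸ hac.symm
  by_cases hc : c ∈ D
  · refine ⟨insert c' (D \ {x}), ⟨fun v => ?_, ?_⟩, Or.inl (hcardN c')⟩
    · by_cases hv : v = x'
      · exact Or.inr ⟨c', mem_insert _ _, hv ▸ hx'c'⟩
      · exact (hdom' hc v hv).imp Or.inr fun ⟨u, hu, huv⟩ => ⟨u, Or.inr hu, huv⟩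
    · exact induce_connected_insert_of_dominated (h.connected_diff_singleton hconn hc)
        (hdom' hc c' h'.ne)
  have hDA : D ⊆ A := fun z hz => by
    by_contra hzA
    exact hc (h.mem_of_connected hconn hx h.mem hz hzA)
  have hcc : c' = c := by
    rcases hdom c' h'.ne with hD' | ⟨u, hu, huc⟩
    · exact absurd hD' hc'
    · exact (h.closed u (hDA hu) c' huc).resolve_left hc'A
  subst hcc
  obtain ⟨a, haA, hac⟩ := h.exists_adj hG
  refine ⟨{a, c'}, ⟨fun v => ?_, ?_⟩, Or.inr ?_⟩
  · by_cases hvA : v ∈ A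
    · rcases h.dominated_pair haA hvA with h1 | rfl | h1
      exacts [Or.inr ⟨c', by simp, h1⟩, Or.inl (by simp), Or.inr ⟨a, by simp, h1⟩]
    by_cases hvx' : v = x'
    · exact Or.inr ⟨c', by simp, hvx' ▸ hx'c'⟩
    rcases hdom v hvx' with hvD | ⟨u, hu, huv⟩
    · exact absurd (hDA hvD) hvA
    · exact Or.inl (by simp [(h.closed u (hDA hu) v huv).resolve_left hvA])
  · exact induce_connected_insert (induce_singleton_connected G c') rfl hac.symm
  · have h1 := ncard_insert_le a {c'}
    have h2 := ncard_singleton c'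
    omega

/-- For two disjoint small ends, joining their marked vertices does not lower the connected
domination number, unless that number is at most three. -/
theorem exists_isCDS_of_addEdge [Finite V] {D : Set V} (hG : G.Connected)
    (h : IsSmallEnd G A c x) (h' : IsSmallEnd G A' c' x') (hAA : Disjoint A A')
    (hcA' : c ∉ A') (hc'A : c' ∉ A) (hD : IsCDS (addEdge G x x') D) :
    ∃ N, IsCDS G N ∧ (N.ncard ≤ D.ncard ∨ N.ncard ≤ 3) := by
  by_cases hx : x ∈ D <;> by_cases hx' : x' ∈ D
  · have hdom : ∀ v, v ∈ D ∨ ∃ u ∈ D, G.Adj u v := by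
      intro v
      rcases hD.1 v with hv | ⟨u, hu, huv⟩
      · exact Or.inl hv
      rcases addEdge_adj.1 huv with huv | ⟨⟨-, rfl⟩ | ⟨-, rfl⟩, -⟩
      exacts [Or.inr ⟨u, hu, huv⟩, Or.inl hx', Or.inl hx]
    by_cases hconn : (G.induce D).Connected
    · exact ⟨D, ⟨hdom, hconn⟩, Or.inl le_rfl⟩
    · obtain ⟨S, S', rfl, hSS, hxS, hxS', hS, hS'⟩ := exists_disjoint_union_of_addEdge hD.2 hconn
      exact exists_isCDS_of_disjoint_union hG h h' hAA hcA' hc'A hS hS' hSS hxS hxS' hdom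
  · exact exists_isCDS_of_mem_of_notMem hG h h' hAA hcA' hc'A hD hx hx'
  · rw [addEdge_comm] at hD
    exact exists_isCDS_of_mem_of_notMem hG h' h hAA.symm hc'A hcA' hD hx' hx
  · refine ⟨D, ⟨fun v => (hD.1 v).imp id ?_, ?_⟩, Or.inl le_rfl⟩
    · rintro ⟨u, hu, huv⟩
      rcases addEdge_adj.1 huv with huv | ⟨⟨rfl, -⟩ | ⟨rfl, -⟩, -⟩
      exacts [⟨u, hu, huv⟩, absurd hu hx, absurd hu hx']
    · exact induce_connected_of_addEdge hD.2 fun e => hx e.1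

end TwoEnds

/-- A graph with a cut vertex has two disjoint branches without cut vertices. -/
theorem exists_disjoint_branches [Finite V] {G : SimpleGraph V} (hG : G.Connected) {c o : V}
    (hc : IsCutVertex G c) (hoc : o ≠ c) : ∃ A A' c₁ c₂, IsBranch G A c₁ ∧ IsBranch G A' c₂ ∧
      (∀ v ∈ A, ¬ IsCutVertex G v) ∧ (∀ v ∈ A', ¬ IsCutVertex G v) ∧ Disjoint A A' := by
  obtain ⟨B, hB, -⟩ := hc.exists_isBranch hoc
  obtain ⟨b, hb⟩ := hB.nonempty
  obtain ⟨B', hB', hbB'⟩ := hc.exists_isBranch (c := b) (fun e => hB.notMem (e ▸ hb))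
  have hdisj : Disjoint B B' := disjoint_left.2 fun z hz hz' =>
    hB.notMem (hB'.mem_of_connected hB.conn hz hz' hb hbB')
  obtain ⟨A, hA, c₁, hb₁, hcut₁⟩ := hB.exists_end hG
  obtain ⟨A', hA', c₂, hb₂, hcut₂⟩ := hB'.exists_end hG
  exact ⟨A, A', c₁, c₂, hb₁, hb₂, hcut₁, hcut₂, hdisj.mono hA hA'⟩

theorem connDomNum_le {G : SimpleGraph V} {D : Set V} (hD : IsCDS G D) :
    connDomNum G ≤ D.ncard := Nat.sInf_le ⟨D, hD, rfl⟩

theorem IsCDS.exists_ncard_eq {G : SimpleGraph V} {D : Set V} (hD : IsCDS G D) :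
    ∃ D', IsCDS G D' ∧ D'.ncard = connDomNum G :=
  Nat.sInf_mem (s := {n | ∃ D, IsCDS G D ∧ D.ncard = n}) ⟨_, D, hD, rfl⟩

/-- If `G` is `k`-`γc`-critical (`k ≥ 4`) with exactly `k - 3` cut
vertices and `D` is a `γc`-set, then `G` has an end block `B` (a block containing
exactly one cut vertex) with `|(D ∩ V(B)) \ C(G)| ≥ 2`. -/
theorem statement10 (k : ℕ) (hk : 4 ≤ k) (V : Type) [Fintype V] (G : SimpleGraph V)
    (hcrit : IsCritical G k) (hcut : (cutVertices G).ncard = k - 3)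
    (D : Set V) (hD : IsGammaCSet G D) :
    ∃ B : Set V, IsBlock G B ∧ (B ∩ cutVertices G).ncard = 1 ∧
      2 ≤ ((D ∩ B) \ cutVertices G).ncard := by
  obtain ⟨hDcds, hDcard⟩ := hD
  obtain ⟨hGk, hadd⟩ := hcrit
  have hG := hDcds.connected
  have hmin : ∀ D', IsCDS G D' → D.ncard ≤ D'.ncard := fun D' hD' =>
    hDcard ▸ connDomNum_le hD'
  have hcritD : ∀ u v, u ≠ v → ¬ G.Adj u v → ∃ D', IsCDS (addEdge G u v) D' ∧
      D'.ncard < D.ncard := by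
    intro u v huv hnadj
    obtain ⟨D', hD', hcard⟩ := (hDcds.of_addEdge u v).exists_ncard_eq
    exact ⟨D', hD', by rw [hcard, hDcard, hGk]; exact hadd u v huv hnadj⟩
  obtain ⟨c, hc⟩ : (cutVertices G).Nonempty := by
    rw [← ncard_pos (toFinite _)]
    omega
  obtain ⟨o, -, hoc⟩ := exists_ne_of_one_lt_ncard (s := D) (by omega) c
  obtain ⟨A, A', c₁, c₂, h₁, h₂, hcut₁, hcut₂, hdisj⟩ := exists_disjoint_branches hG hc hoc
  have main : ∀ {A c}, IsBranch G A c → (∀ v ∈ A, ¬ IsCutVertex G v) → 1 < (D ∩ A).ncard →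
      ∃ B : Set V, IsBlock G B ∧ (B ∩ cutVertices G).ncard = 1 ∧
        2 ≤ ((D ∩ B) \ cutVertices G).ncard := by
    intro A c h hcut hcard
    have hcG : IsCutVertex G c := h.isCutVertex hG
    refine ⟨insert c A, h.isBlock hG hcut, ?_, ?_⟩
    · rw [ncard_eq_one]
      refine ⟨c, Subset.antisymm ?_ ?_⟩
      · rintro z ⟨rfl | hz, hzc⟩
        exacts [rfl, absurd hzc (hcut z hz)]
      · rintro z rfl
        exact ⟨mem_insert _ _, hcG⟩
    · exact hcard.trans_le (ncard_le_ncard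
        (fun z hz => ⟨⟨hz.1, Or.inr hz.2⟩, hcut z hz.2⟩) (toFinite _))
  by_cases hc₁ : 1 < (D ∩ A).ncard
  · exact main h₁ hcut₁ hc₁
  by_cases hc₂ : 1 < (D ∩ A').ncard
  · exact main h₂ hcut₂ hc₂
  exfalso
  obtain ⟨x, hx⟩ := h₁.exists_isSmallEnd hDcds hmin hcritD (not_lt.1 hc₁)
  obtain ⟨x', hx'⟩ := h₂.exists_isSmallEnd hDcds hmin hcritD (not_lt.1 hc₂)
  have hc₁A' : c₁ ∉ A' := fun hA => hcut₂ c₁ hA (h₁.isCutVertex hG)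
  have hc₂A : c₂ ∉ A := fun hA => hcut₁ c₂ hA (h₂.isCutVertex hG)
  have hx'A : x' ∉ A := disjoint_right.1 hdisj hx'.mem
  obtain ⟨D', hD', hlt⟩ := hcritD x x' (fun e => hx'A (e ▸ hx.mem)) fun hadj =>
    (hx.closed x hx.mem x' hadj).elim hx'A fun e => hc₁A' (e ▸ hx'.mem)
  obtain ⟨N, hN, hcard⟩ := exists_isCDS_of_addEdge hG hx hx' hdisj hc₁A' hc₂A hD'
  have := hmin N hN
  omega
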